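/- Let G be the k-sum of graphs G₁ and G₂ along a clique K of size k (so V(G₁) ∩ V(G₂) = K, K is a clique in both G₁ and G₂, and G is obtained by gluing G₁ and G₂ along K, keeping all edges of K). Then tree-χ(G) ≤ max(tree-χ(G₁), tree-χ(G₂)). -/

import Mathlib

open SimpleGraph

/-- The chromatic number of a graph, as a natural number. -/
noncomputable def chromNat {V : Type} (G : SimpleGraph V) : ℕ :=
  sInf {k : ℕ | G.Colorable k}

/-- A tree-decomposition of a graph `G`: a tree `T` together with bags `B_t ⊆ V(G)`
such that every edge of `G` lies in some bag and, for each vertex `v`, the set of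
nodes whose bag contains `v` induces a non-empty subtree of `T`. -/
structure TreeDecomp {V : Type} (G : SimpleGraph V) : Type 1 where
  ι : Type
  fin : Finite ι
  T : SimpleGraph ι
  isTree : T.IsTree
  bag : ι → Set V
  covers : ∀ ⦃u v : V⦄, G.Adj u v → ∃ t, u ∈ bag t ∧ v ∈ bag t
  conn : ∀ v : V, (T.induce {t | v ∈ bag t}).Connected

/-- The chromatic number of a tree-decomposition: the maximum over bags of the
chromatic number of the induced subgraph. -/
noncomputable def TreeDecomp.chrom {V : Type} {G : SimpleGraph V} (D : TreeDecomp G) : ℕ :=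
  sSup {m : ℕ | ∃ t, chromNat (G.induce (D.bag t)) = m}

/-- The tree-chromatic number of `G`. -/
noncomputable def treeChi {V : Type} (G : SimpleGraph V) : ℕ :=
  sInf {m : ℕ | ∃ D : TreeDecomp G, D.chrom = m}

namespace SimpleGraph

lemma exists_isPath_of_preconnected_induce {ι : Type*} {T : SimpleGraph ι} {S : Set ι}
    (hS : (T.induce S).Preconnected) {a b : ι} (ha : a ∈ S) (hb : b ∈ S) :
    ∃ p : T.Walk a b, p.IsPath ∧ ∀ x ∈ p.support, x ∈ S := by
  classical
  obtain ⟨q⟩ := hS ⟨a, ha⟩ ⟨b, hb⟩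
  let q' : T.Walk a b := q.map (Embedding.induce S).toHom
  refine ⟨q'.bypass, q'.bypass_isPath, fun x hx => ?_⟩
  have hx' : x ∈ q'.support := q'.support_bypass_subset_support hx
  obtain ⟨y, -, rfl⟩ := List.mem_map.1 (Walk.support_map _ q ▸ hx')
  exact y.2

/-- In an acyclic graph, a path between two vertices of a set inducing a preconnected subgraph
stays in that set. -/
lemma IsAcyclic.support_subset_of_preconnected_induce {ι : Type*} {T : SimpleGraph ι}
    (hT : T.IsAcyclic) {S : Set ι} (hS : (T.induce S).Preconnected) {a b : ι}
    (ha : a ∈ S) (hb : b ∈ S) {p : T.Walk a b} (hp : p.IsPath) : ∀ x ∈ p.support, x ∈ S := by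
  obtain ⟨q, hq, hqS⟩ := exists_isPath_of_preconnected_induce hS ha hb
  have hpq : p = q := congrArg Subtype.val ((hT.subsingleton_path a b).elim ⟨p, hp⟩ ⟨q, hq⟩)
  exact hpq ▸ hqS

lemma IsAcyclic.preconnected_induce_inter {ι : Type*} {T : SimpleGraph ι} (hT : T.IsAcyclic)
    {A B : Set ι} (hA : (T.induce A).Preconnected) (hB : (T.induce B).Preconnected) :
    (T.induce (A ∩ B)).Preconnected := by
  rintro ⟨a, haA, haB⟩ ⟨b, hbA, hbB⟩
  obtain ⟨p, hp, hpA⟩ := exists_isPath_of_preconnected_induce hA haA hbA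
  have hpB := hT.support_subset_of_preconnected_induce hB haB hbB hp
  exact ⟨p.induce (A ∩ B) fun x hx => ⟨hpA x hx, hpB x hx⟩⟩

lemma IsAcyclic.mem_or_mem_of_adj {ι : Type*} {T : SimpleGraph ι} (hT : T.IsAcyclic)
    {B C : Set ι} (hB : (T.induce B).Preconnected) (hC : (T.induce C).Preconnected)
    (hBC : (B ∩ C).Nonempty) {x y : ι} (hx : x ∈ C) (hy : y ∈ B) (hxy : T.Adj x y) :
    x ∈ B ∨ y ∈ C := by
  obtain ⟨z, hzB, hzC⟩ := hBC
  obtain ⟨q, hq, hqB⟩ := exists_isPath_of_preconnected_induce hB hy hzB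
  by_contra! h
  have hcons : (Walk.cons hxy q).IsPath := hq.cons fun hxq => h.1 (hqB x hxq)
  exact h.2 (hT.support_subset_of_preconnected_induce hC hx hzC hcons y (by simp))

/-- Three pairwise intersecting subtrees of an acyclic graph have a common vertex. -/
lemma IsAcyclic.inter_inter_nonempty {ι : Type*} {T : SimpleGraph ι} (hT : T.IsAcyclic)
    {A B C : Set ι} (hA : (T.induce A).Preconnected) (hB : (T.induce B).Preconnected)
    (hC : (T.induce C).Preconnected) (hAB : (A ∩ B).Nonempty) (hAC : (A ∩ C).Nonempty)
    (hBC : (B ∩ C).Nonempty) : (A ∩ B ∩ C).Nonempty := by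
  have key : ∀ {x y : ι} (p : T.Walk x y), (∀ z ∈ p.support, z ∈ A ∧ (z ∈ B ∨ z ∈ C)) →
      x ∈ C → y ∈ B → (A ∩ B ∩ C).Nonempty := by
    intro x y p
    induction p with
    | nil => exact fun h hx hy => ⟨_, ⟨(h _ (by simp)).1, hy⟩, hx⟩
    | cons hadj p ih =>
      rename_i u v w
      intro h hu hw
      have hv := h v (by simp)
      by_cases hvC : v ∈ C
      · exact ih (fun z hz => h z (by simp [hz])) hvC hw
      · have huB := (hT.mem_or_mem_of_adj hB hC hBC hu (hv.2.resolve_right hvC) hadj).resolve_right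
          hvC
        exact ⟨u, ⟨(h u (by simp)).1, huB⟩, hu⟩
  obtain ⟨b, hbA, hbB⟩ := hAB
  obtain ⟨c, hcA, hcC⟩ := hAC
  obtain ⟨p, hp, hpA⟩ := exists_isPath_of_preconnected_induce hA hcA hbA
  have hpBC := hT.support_subset_of_preconnected_induce
    (induce_union_connected hB hC hBC).preconnected (Or.inr hcC) (Or.inl hbB) hp
  exact key p (fun z hz => ⟨hpA z hz, hpBC z hz⟩) hcC hbB

/-- The Helly property for subtrees of an acyclic graph. -/
lemma IsAcyclic.exists_mem_of_pairwise_inter_nonempty {ι α : Type*} {T : SimpleGraph ι}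
    (hT : T.IsAcyclic) {f : α → Set ι} (hf : ∀ a, (T.induce (f a)).Preconnected) (s : Finset α)
    (hs : ∀ a ∈ s, ∀ b ∈ s, (f a ∩ f b).Nonempty) {S : Set ι} (hS : (T.induce S).Preconnected)
    (hne : S.Nonempty) (hSs : ∀ a ∈ s, (S ∩ f a).Nonempty) :
    ∃ t ∈ S, ∀ a ∈ s, t ∈ f a := by
  classical
  induction s using Finset.induction_on generalizing S with
  | empty => exact ⟨hne.some, hne.some_mem, by simp⟩
  | insert a s has ih =>
    obtain ⟨t, ht, hts⟩ := ih (fun b hb c hc => hs b (by simp [hb]) c (by simp [hc]))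
      (hT.preconnected_induce_inter hS (hf a)) (hSs a (by simp))
      (fun b hb => hT.inter_inter_nonempty hS (hf a) (hf b) (hSs a (by simp))
        (hSs b (by simp [hb])) (hs a (by simp) b (by simp [hb])))
    refine ⟨t, ht.1, fun b hb => ?_⟩
    rcases Finset.mem_insert.1 hb with rfl | hb
    exacts [ht.2, hts b hb]

/-- Joining two finite trees by an edge yields a tree. -/
lemma IsTree.sum_sup_edge {ι κ : Type*} [Finite ι] [Finite κ] {T : SimpleGraph ι}
    {T' : SimpleGraph κ} (hT : T.IsTree) (hT' : T'.IsTree) (s : ι) (t : κ) :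
    (T.sum T' ⊔ edge (.inl s) (.inr t)).IsTree := by
  have hc := (isTree_iff_connected_and_card.1 hT).2
  have hc' := (isTree_iff_connected_and_card.1 hT').2
  refine isTree_iff_connected_and_card.2 ⟨hT.connected.sum_sup_edge hT'.connected, ?_⟩
  have hsum := Nat.card_congr (edgeSetSumEquiv (G := T) (H := T'))
  rw [Nat.card_sum] at hsum
  have hnot : s(Sum.inl s, Sum.inr t) ∉ (T.sum T').edgeSet := by simp
  rw [edgeSet_sup, edgeSet_edge_of_ne (by simp), Set.union_singleton, Nat.card_coe_set_eq,
    Set.ncard_insert_of_notMem hnot (Set.toFinite _), ← Nat.card_coe_set_eq, hsum, Nat.card_sum]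
  omega

lemma Preconnected.induce_image {ι κ : Type*} {T : SimpleGraph ι} {T' : SimpleGraph κ} {S : Set ι}
    (hS : (T.induce S).Preconnected) (f : T →g T') : (T'.induce (f '' S)).Preconnected := by
  let g : T.induce S →g T'.induce (f '' S) :=
    ⟨fun x => ⟨f x, x, x.2, rfl⟩, fun h => f.map_adj h⟩
  rintro ⟨-, x, hx, rfl⟩ ⟨-, y, hy, rfl⟩
  exact (hS ⟨x, hx⟩ ⟨y, hy⟩).map g

end SimpleGraph

lemma chromNat_le_of_hom {V W : Type} [Finite W] {G : SimpleGraph V} {H : SimpleGraph W}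
    (f : G →g H) : chromNat G ≤ chromNat H := by
  have := Fintype.ofFinite W
  have hH : H.Colorable (chromNat H) :=
    Nat.sInf_mem (s := {k : ℕ | H.Colorable k}) ⟨_, H.colorable_of_fintype⟩
  exact Nat.sInf_le (Colorable.of_hom f hH)

namespace TreeDecomp

variable {V : Type} {G : SimpleGraph V}

/-- The tree-decomposition with a single bag. -/
def single (G : SimpleGraph V) : TreeDecomp G where
  ι := Unit
  fin := inferInstance
  T := ⊥
  isTree := .of_subsingleton
  bag _ := Set.univ
  covers _ _ _ := ⟨(), trivial, trivial⟩
  conn _ := (connected_iff _).2 ⟨.of_subsingleton, ⟨(), trivial⟩⟩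

lemma chromNat_bag_le_chrom (D : TreeDecomp G) (t : D.ι) :
    chromNat (G.induce (D.bag t)) ≤ D.chrom :=
  have := D.fin
  le_csSup (Set.finite_range fun t => chromNat (G.induce (D.bag t))).bddAbove ⟨t, rfl⟩

lemma chrom_le (D : TreeDecomp G) {m : ℕ} (h : ∀ t, chromNat (G.induce (D.bag t)) ≤ m) :
    D.chrom ≤ m := by
  obtain ⟨t⟩ := D.isTree.connected.nonempty
  refine csSup_le ⟨_, t, rfl⟩ ?_
  rintro _ ⟨t, rfl⟩
  exact h t

lemma exists_chrom_eq_treeChi (G : SimpleGraph V) : ∃ D : TreeDecomp G, D.chrom = treeChi G :=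
  Nat.sInf_mem (s := {m : ℕ | ∃ D : TreeDecomp G, D.chrom = m}) ⟨_, single G, rfl⟩

lemma treeChi_le_chrom (D : TreeDecomp G) : treeChi G ≤ D.chrom :=
  Nat.sInf_le ⟨D, rfl⟩

/-- Every finite clique is contained in a bag. -/
lemma exists_clique_subset_bag (D : TreeDecomp G) {K : Set V} (hfin : K.Finite)
    (hK : G.IsClique K) : ∃ t, K ⊆ D.bag t := by
  have hne : ∀ v, ({t | v ∈ D.bag t} : Set D.ι).Nonempty := fun v =>
    Set.nonempty_coe_sort.1 (D.conn v).nonempty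
  have hpair : ∀ a ∈ hfin.toFinset, ∀ b ∈ hfin.toFinset,
      ({t | a ∈ D.bag t} ∩ {t | b ∈ D.bag t} : Set D.ι).Nonempty := by
    intro a ha b hb
    by_cases hab : a = b
    · subst hab
      rw [Set.inter_self]
      exact hne a
    · exact D.covers (hK (hfin.mem_toFinset.1 ha) (hfin.mem_toFinset.1 hb) hab)
  obtain ⟨t₀⟩ := D.isTree.connected.nonempty
  obtain ⟨t, -, ht⟩ := D.isTree.isAcyclic.exists_mem_of_pairwise_inter_nonempty
    (f := fun v => {t | v ∈ D.bag t}) (fun v => (D.conn v).preconnected) hfin.toFinset hpair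
    (S := Set.univ)
    ((induceUnivIso D.T).symm.connected_iff.1 D.isTree.connected).preconnected ⟨t₀, trivial⟩
    (fun a _ => by rw [Set.univ_inter]; exact hne a)
  exact ⟨t, fun v hv => ht v (hfin.mem_toFinset.2 hv)⟩

/-- Two tree-decompositions of subgraphs covering `G` glued by an edge between two nodes whose
bags both contain all common vertices. -/
def glue {H₁ H₂ : G.Subgraph} (hunion : H₁ ⊔ H₂ = ⊤) (D₁ : TreeDecomp H₁.coe)
    (D₂ : TreeDecomp H₂.coe) (t₁ : D₁.ι) (t₂ : D₂.ι)
    (h₁ : ∀ v (h : v ∈ H₁.verts), v ∈ H₂.verts → ⟨v, h⟩ ∈ D₁.bag t₁)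
    (h₂ : ∀ v (h : v ∈ H₂.verts), v ∈ H₁.verts → ⟨v, h⟩ ∈ D₂.bag t₂) : TreeDecomp G where
  ι := D₁.ι ⊕ D₂.ι
  fin := have := D₁.fin; have := D₂.fin; inferInstance
  T := D₁.T.sum D₂.T ⊔ edge (.inl t₁) (.inr t₂)
  isTree := have := D₁.fin; have := D₂.fin; D₁.isTree.sum_sup_edge D₂.isTree t₁ t₂
  bag := Sum.elim (fun t => Subtype.val '' D₁.bag t) (fun t => Subtype.val '' D₂.bag t)
  covers u v huv := by
    have h : (H₁ ⊔ H₂).Adj u v := by simpa [hunion] using huv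
    rcases Subgraph.sup_adj.1 h with h | h
    · obtain ⟨t, hu, hv⟩ := D₁.covers (u := ⟨u, h.fst_mem⟩) (v := ⟨v, h.snd_mem⟩) h
      exact ⟨.inl t, ⟨_, hu, rfl⟩, ⟨_, hv, rfl⟩⟩
    · obtain ⟨t, hu, hv⟩ := D₂.covers (u := ⟨u, h.fst_mem⟩) (v := ⟨v, h.snd_mem⟩) h
      exact ⟨.inr t, ⟨_, hu, rfl⟩, ⟨_, hv, rfl⟩⟩
  conn v := by
    set T := D₁.T.sum D₂.T ⊔ edge (.inl t₁) (.inr t₂) with hT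
    let f₁ : D₁.T →g T := (Hom.ofLE le_sup_left).comp Embedding.sumInl.toHom
    let f₂ : D₂.T →g T := (Hom.ofLE le_sup_left).comp Embedding.sumInr.toHom
    have hadj : T.Adj (.inl t₁) (.inr t₂) := by simp [hT, edge]
    have c₁ := fun h : v ∈ H₁.verts => (D₁.conn ⟨v, h⟩).preconnected.induce_image f₁
    have c₂ := fun h : v ∈ H₂.verts => (D₂.conn ⟨v, h⟩).preconnected.induce_image f₂
    have n₁ := fun h : v ∈ H₁.verts =>
      (Set.nonempty_coe_sort.1 (D₁.conn ⟨v, h⟩).nonempty).image f₁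
    have n₂ := fun h : v ∈ H₂.verts =>
      (Set.nonempty_coe_sort.1 (D₂.conn ⟨v, h⟩).nonempty).image f₂
    have hv : v ∈ H₁.verts ∨ v ∈ H₂.verts := by
      have : v ∈ (H₁ ⊔ H₂).verts := by simp [hunion]
      simpa using this
    by_cases hv₁ : v ∈ H₁.verts <;> by_cases hv₂ : v ∈ H₂.verts
    · have := connected_induce_union (c₁ hv₁) (c₂ hv₂) ⟨t₁, h₁ v hv₁ hv₂, rfl⟩
        ⟨t₂, h₂ v hv₂ hv₁, rfl⟩ hadj
      refine (congrArg (fun S => (T.induce S).Connected) ?_).mp this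
      ext (t | t) <;> simp [f₁, f₂, hv₁, hv₂]
    · have := (connected_iff _).2 ⟨c₁ hv₁, (n₁ hv₁).to_subtype⟩
      refine (congrArg (fun S => (T.induce S).Connected) ?_).mp this
      ext (t | t) <;> simp [f₁, hv₁, hv₂]
    · have := (connected_iff _).2 ⟨c₂ hv₂, (n₂ hv₂).to_subtype⟩
      refine (congrArg (fun S => (T.induce S).Connected) ?_).mp this
      ext (t | t) <;> simp [f₂, hv₁, hv₂]
    · tauto

end TreeDecomp

/-- Passing from an induced subgraph `H` to `G` does not increase the chromatic number of the graph
induced by a set of vertices of `H`. -/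
lemma chromNat_induce_image_le {V : Type} [Finite V] {G : SimpleGraph V} {H : G.Subgraph}
    (hH : H.IsInduced) (B : Set H.verts) :
    chromNat (G.induce (Subtype.val '' B)) ≤ chromNat (H.coe.induce B) := by
  have hmem : ∀ x : (Subtype.val '' B : Set V), ∃ h : (x : V) ∈ H.verts, (⟨x, h⟩ : H.verts) ∈ B := by
    rintro ⟨-, y, hy, rfl⟩
    exact ⟨y.2, hy⟩
  exact chromNat_le_of_hom
    ⟨fun x => ⟨⟨x, (hmem x).1⟩, (hmem x).2⟩, fun {x y} h => hH (hmem x).1 (hmem y).1 h⟩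

/-- If `G` is the `k`-sum of `G₁` and `G₂` along a clique `K` of
size `k` (so `V(G₁) ∩ V(G₂) = K`, `K` is a clique in both, and `G = G₁ ∪ G₂` keeping
all edges of `K`), then `tree-χ(G) ≤ max(tree-χ(G₁), tree-χ(G₂))`.  Here `G₁` and
`G₂` are given as subgraphs `H₁`, `H₂` of `G`. -/
theorem stmt13 {V : Type} [Fintype V] (G : SimpleGraph V) (k : ℕ) (K : Set V)
    (H₁ H₂ : G.Subgraph)
    (hunion : H₁ ⊔ H₂ = ⊤)
    (hinter : H₁.verts ∩ H₂.verts = K)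
    (hcard : K.ncard = k)
    (hK1 : ∀ u ∈ K, ∀ v ∈ K, u ≠ v → H₁.Adj u v)
    (hK2 : ∀ u ∈ K, ∀ v ∈ K, u ≠ v → H₂.Adj u v) :
    treeChi G ≤ max (treeChi H₁.coe) (treeChi H₂.coe) := by
  have hadj : ∀ u v, G.Adj u v → H₁.Adj u v ∨ H₂.Adj u v := fun u v huv =>
    Subgraph.sup_adj.1 (by simpa [hunion] using huv)
  have hi₁ : H₁.IsInduced := fun u hu v hv huv => (hadj u v huv).elim id fun h =>
    hK1 u (hinter ▸ ⟨hu, h.fst_mem⟩) v (hinter ▸ ⟨hv, h.snd_mem⟩) huv.ne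
  have hi₂ : H₂.IsInduced := fun u hu v hv huv => (hadj u v huv).elim (fun h =>
    hK2 u (hinter ▸ ⟨h.fst_mem, hu⟩) v (hinter ▸ ⟨h.snd_mem, hv⟩) huv.ne) id
  obtain ⟨D₁, hD₁⟩ := TreeDecomp.exists_chrom_eq_treeChi H₁.coe
  obtain ⟨D₂, hD₂⟩ := TreeDecomp.exists_chrom_eq_treeChi H₂.coe
  obtain ⟨t₁, ht₁⟩ := D₁.exists_clique_subset_bag (K := Subtype.val ⁻¹' K) (Set.toFinite _)
    fun u hu v hv huv => hK1 u hu v hv (Subtype.coe_ne_coe.2 huv)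
  obtain ⟨t₂, ht₂⟩ := D₂.exists_clique_subset_bag (K := Subtype.val ⁻¹' K) (Set.toFinite _)
    fun u hu v hv huv => hK2 u hu v hv (Subtype.coe_ne_coe.2 huv)
  let D := TreeDecomp.glue hunion D₁ D₂ t₁ t₂
    (fun v h h' => ht₁ (show v ∈ K from hinter ▸ ⟨h, h'⟩))
    (fun v h h' => ht₂ (show v ∈ K from hinter ▸ ⟨h', h⟩))
  refine D.treeChi_le_chrom.trans (D.chrom_le ?_)
  rintro (t | t)
  · exact le_max_of_le_left
      ((chromNat_induce_image_le hi₁ _).trans (hD₁ ▸ D₁.chromNat_bag_le_chrom t))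
  · exact le_max_of_le_right
      ((chromNat_induce_image_le hi₂ _).trans (hD₂ ▸ D₂.chromNat_bag_le_chrom t))
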